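/- arXiv:2112.13766 — 2 statements merged into one kernel-verified Lean document; each statement's English description precedes it below -/
import Mathlib

section
/- For every integer m ≥ 3, the number (2m+1)·C(2m, m) does not divide (4m+1)·C(4m, 2m). -/
open Finset ArithmeticFunction in
theorem log_factorial_eq_sum_vonMangoldt (n : ℕ) :
    Real.log n.factorial = ∑ k ∈ Ioc 0 n, vonMangoldt k * (n / k : ℕ) := by
  induction n with
  | zero => simp
  | succ n ih =>
    have hdiv : ∀ k ∈ Ioc 0 (n + 1), (vonMangoldt k * ((n + 1) / k : ℕ) : ℝ) =
        vonMangoldt k * (n / k : ℕ) + if k ∣ n + 1 then vonMangoldt k else 0 := by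
      intro k _
      rw [Nat.succ_div]
      split_ifs <;> push_cast <;> ring
    rw [sum_congr rfl hdiv, sum_add_distrib, sum_Ioc_succ_top (Nat.zero_le n), ← ih,
      Nat.div_eq_of_lt (Nat.lt_succ_self n), ← sum_filter, Nat.factorial_succ, Nat.cast_mul,
      Real.log_mul (by positivity) (by positivity), ← vonMangoldt_sum]
    have : (Ioc 0 (n + 1)).filter (· ∣ n + 1) = (n + 1).divisors := by
      ext k
      simp only [mem_filter, mem_Ioc, Nat.mem_divisors]
      exact ⟨fun h => ⟨h.2, by lia⟩,
        fun h => ⟨⟨Nat.pos_of_dvd_of_pos h.1 (by lia), Nat.le_of_dvd (by lia) h.1⟩, h.1⟩⟩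
    rw [this]
    simp [add_comm]

open Finset ArithmeticFunction in
theorem log_factorial_div_eq_sum_vonMangoldt (n d : ℕ) :
    Real.log (n / d).factorial = ∑ k ∈ Ioc 0 n, vonMangoldt k * (n / k / d : ℕ) := by
  rw [log_factorial_eq_sum_vonMangoldt]
  have hsub : Ioc 0 (n / d) ⊆ Ioc 0 n := Ioc_subset_Ioc_right (Nat.div_le_self n d)
  rw [← sum_subset hsub]
  · refine sum_congr rfl fun k _ => ?_
    rw [Nat.div_div_eq_div_mul, Nat.div_div_eq_div_mul, mul_comm d k]
  · intro k hk hk'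
    rw [mem_Ioc] at hk hk'
    rw [Nat.div_div_eq_div_mul, mul_comm k d, ← Nat.div_div_eq_div_mul,
      Nat.div_eq_of_lt (by lia)]
    simp

/-- The logarithm of Chebyshev's quotient `n! (n/30)! / ((n/2)! (n/3)! (n/5)!)`. -/
noncomputable def logChebyshevQuotient (n : ℕ) : ℝ :=
  Real.log n.factorial - Real.log (n / 2).factorial - Real.log (n / 3).factorial
    - Real.log (n / 5).factorial + Real.log (n / 30).factorial

open Finset ArithmeticFunction in
theorem logChebyshevQuotient_eq_sum (n : ℕ) :
    logChebyshevQuotient n = ∑ k ∈ Ioc 0 n, vonMangoldt k *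
      ((n / k : ℕ) - (n / k / 2 : ℕ) - (n / k / 3 : ℕ) - (n / k / 5 : ℕ) + (n / k / 30 : ℕ)) := by
  simp only [logChebyshevQuotient, log_factorial_div_eq_sum_vonMangoldt,
    log_factorial_eq_sum_vonMangoldt n, ← sum_sub_distrib, ← sum_add_distrib]
  exact sum_congr rfl fun k _ => by ring

open Finset ArithmeticFunction in
theorem logChebyshevQuotient_le_psi (n : ℕ) : logChebyshevQuotient n ≤ Chebyshev.psi n := by
  rw [logChebyshevQuotient_eq_sum, Chebyshev.psi, Nat.floor_natCast]
  refine sum_le_sum fun k _ => mul_le_of_le_one_right vonMangoldt_nonneg ?_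
  generalize n / k = q
  have : q + q / 30 ≤ 1 + q / 2 + q / 3 + q / 5 := by lia
  have : (q + (q / 30 : ℕ) : ℝ) ≤ 1 + (q / 2 : ℕ) + (q / 3 : ℕ) + (q / 5 : ℕ) := by
    exact_mod_cast this
  linarith

open Finset ArithmeticFunction in
theorem psi_le_logChebyshevQuotient_add (n : ℕ) :
    Chebyshev.psi n ≤ logChebyshevQuotient n + Chebyshev.psi (n / 6 : ℕ) := by
  rw [logChebyshevQuotient_eq_sum, Chebyshev.psi, Chebyshev.psi, Nat.floor_natCast,
    Nat.floor_natCast]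
  have hfilter : Ioc 0 (n / 6) = (Ioc 0 n).filter (· ≤ n / 6) := by
    ext k
    simp only [mem_filter, mem_Ioc]
    lia
  rw [hfilter, sum_filter, ← sum_add_distrib]
  refine sum_le_sum fun k hk => ?_
  rw [mem_Ioc] at hk
  have hΛ : 0 ≤ vonMangoldt k := vonMangoldt_nonneg
  have hq : 1 ≤ n / k := (Nat.one_le_div_iff hk.1).2 hk.2
  have hq6 : ¬ k ≤ n / 6 → n / k < 6 := fun h => by
    rw [Nat.le_div_iff_mul_le (by norm_num)] at h
    rw [Nat.div_lt_iff_lt_mul hk.1]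
    lia
  generalize n / k = q at *
  split_ifs with h
  · have : q / 2 + q / 3 + q / 5 ≤ q + q / 30 := by lia
    have : ((q / 2 : ℕ) + (q / 3 : ℕ) + (q / 5 : ℕ) : ℝ) ≤ q + (q / 30 : ℕ) := by
      exact_mod_cast this
    nlinarith
  · have := hq6 h
    have : 1 + q / 2 + q / 3 + q / 5 ≤ q + q / 30 := by lia
    have : (1 + (q / 2 : ℕ) + (q / 3 : ℕ) + (q / 5 : ℕ) : ℝ) ≤ q + (q / 30 : ℕ) := by
      exact_mod_cast this
    nlinarith

theorem mul_log_sub_self_le {x y : ℝ} (hy : 1 ≤ y) (hxy : y ≤ x) :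
    y * Real.log y - y ≤ x * Real.log x - x := by
  have hx : 0 < x := by linarith
  have h1 : Real.log (y / x) ≤ y / x - 1 := Real.log_le_sub_one_of_pos (by positivity)
  rw [Real.log_div (by positivity) (by positivity)] at h1
  have h2 := mul_le_mul_of_nonneg_left h1 hx.le
  have h3 : x * (y / x - 1) = y - x := by field_simp
  nlinarith [Real.log_nonneg hy]

theorem log_factorial_le {n : ℕ} (hn : n ≠ 0) :
    Real.log n.factorial ≤ n * Real.log n - n + Real.log n / 2 + 1 := by
  obtain ⟨k, rfl⟩ := Nat.exists_eq_succ_of_ne_zero hn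
  have h := Stirling.log_stirlingSeq'_antitone (Nat.zero_le k)
  have hpos : (0 : ℝ) < (k.succ : ℕ) := by positivity
  simp only [Function.comp_apply, Stirling.log_stirlingSeq_formula] at h
  rw [Real.log_mul (by norm_num) hpos.ne', Real.log_div hpos.ne' (Real.exp_pos 1).ne',
    Real.log_exp] at h
  norm_num at h ⊢
  linarith

theorem abs_log_factorial_floor_sub_le {x : ℝ} (hx : 1 ≤ x) :
    |Real.log (⌊x⌋₊).factorial - (x * Real.log x - x)| ≤ Real.log x + 1 := by
  have hn : 1 ≤ ⌊x⌋₊ := Nat.one_le_floor_iff x |>.2 hx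
  have hn' : (1 : ℝ) ≤ ⌊x⌋₊ := by exact_mod_cast hn
  have hle : (⌊x⌋₊ : ℝ) ≤ x := Nat.floor_le (by linarith)
  have hlt : x < ⌊x⌋₊ + 1 := Nat.lt_floor_add_one x
  have hlog : 0 ≤ Real.log x := Real.log_nonneg hx
  rw [abs_le]
  constructor
  · have h1 := Stirling.le_log_factorial_stirling (n := ⌊x⌋₊ + 1) (by lia)
    have h2 := mul_log_sub_self_le hx hlt.le
    have h3 : Real.log (⌊x⌋₊ + 1 : ℝ) ≤ Real.log x + 1 := by
      have : Real.log (⌊x⌋₊ + 1 : ℝ) ≤ Real.log (2 * x) :=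
        Real.log_le_log (by positivity) (by linarith)
      rw [Real.log_mul (by norm_num) (by linarith)] at this
      linarith [Real.log_two_lt_d9]
    have h4 : 0 ≤ Real.log (2 * Real.pi) := Real.log_nonneg (by linarith [Real.pi_gt_three])
    have h5 : 0 ≤ Real.log (⌊x⌋₊ + 1 : ℝ) := Real.log_nonneg (by linarith)
    rw [Nat.factorial_succ, Nat.cast_mul,
      Real.log_mul (x := (⌊x⌋₊ + 1 : ℕ)) (by positivity) (by positivity)] at h1
    push_cast at h1
    linarith
  · have h1 := log_factorial_le (n := ⌊x⌋₊) (by lia)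
    have h2 := mul_log_sub_self_le hn' hle
    have h3 : Real.log ⌊x⌋₊ ≤ Real.log x := Real.log_le_log (by linarith) hle
    linarith

theorem abs_log_factorial_div_sub_le {n d : ℕ} (hd : 0 < d) (h : d ≤ n) :
    |Real.log (n / d).factorial - (n / d * (Real.log n - Real.log d) - n / d)|
      ≤ Real.log n + 1 := by
  have hd' : (1 : ℝ) ≤ d := by exact_mod_cast hd
  have hn : (d : ℝ) ≤ n := by exact_mod_cast h
  have h1 := abs_log_factorial_floor_sub_le (x := (n : ℝ) / d)
    ((one_le_div (by linarith)).2 hn)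
  rw [Nat.floor_div_eq_div, Real.log_div (by linarith) (by linarith)] at h1
  linarith [Real.log_nonneg hd']

theorem abs_logChebyshevQuotient_sub_le {n : ℕ} (hn : 30 ≤ n) :
    |logChebyshevQuotient n -
      n * (14 / 30 * Real.log 2 + 9 / 30 * Real.log 3 + 5 / 30 * Real.log 5)|
      ≤ 5 * (Real.log n + 1) := by
  have h1 := abs_log_factorial_div_sub_le (n := n) (d := 1) (by lia) (by lia)
  have h2 := abs_log_factorial_div_sub_le (n := n) (d := 2) (by lia) (by lia)
  have h3 := abs_log_factorial_div_sub_le (n := n) (d := 3) (by lia) (by lia)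
  have h5 := abs_log_factorial_div_sub_le (n := n) (d := 5) (by lia) (by lia)
  have h30 := abs_log_factorial_div_sub_le (n := n) (d := 30) (by lia) (by lia)
  have hlog : Real.log 30 = Real.log 2 + Real.log 3 + Real.log 5 := by
    rw [← Real.log_mul (by norm_num) (by norm_num), ← Real.log_mul (by norm_num) (by norm_num)]
    norm_num
  simp only [Nat.div_one, Nat.cast_one, Nat.cast_ofNat, div_one, Real.log_one, hlog] at *
  rw [abs_le] at *
  unfold logChebyshevQuotient
  constructor <;> linarith

theorem nat_mul_log_le_of_pow_le {a b : ℝ} {i j : ℕ} (ha : 0 < a) (h : a ^ i ≤ b ^ j) :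
    i * Real.log a ≤ j * Real.log b := by
  rw [← Real.log_pow, ← Real.log_pow]
  exact Real.log_le_log (by positivity) h

theorem logChebyshevQuotient_bounds {n : ℕ} (hn : 20000 ≤ n) :
    0.917 * n ≤ logChebyshevQuotient n ∧ logChebyshevQuotient n ≤ 0.9265 * n := by
  have hn' : (20000 : ℝ) ≤ n := by exact_mod_cast hn
  have h := abs_le.1 (abs_logChebyshevQuotient_sub_le (n := n) (by lia))
  have l2 := Real.log_two_lt_d9
  have l2' := Real.log_two_gt_d9
  have l3 := nat_mul_log_le_of_pow_le (a := 3) (b := 2) (i := 17) (j := 27)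
    (by norm_num) (by norm_num)
  have l3' := nat_mul_log_le_of_pow_le (a := 2) (b := 3) (i := 19) (j := 12)
    (by norm_num) (by norm_num)
  have l5 := nat_mul_log_le_of_pow_le (a := 5) (b := 2) (i := 3) (j := 7)
    (by norm_num) (by norm_num)
  have l5' := nat_mul_log_le_of_pow_le (a := 2) (b := 5) (i := 65) (j := 28)
    (by norm_num) (by norm_num)
  have l20000 := nat_mul_log_le_of_pow_le (a := 20000) (b := 2) (i := 1) (j := 15)
    (by norm_num) (by norm_num)
  have hlog : Real.log (n / 20000) ≤ n / 20000 - 1 :=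
    Real.log_le_sub_one_of_pos (by positivity)
  rw [Real.log_div (by linarith) (by norm_num)] at hlog
  push_cast at *
  set c := 14 / 30 * Real.log 2 + 9 / 30 * Real.log 3 + 5 / 30 * Real.log 5 with hc
  have hc1 : 0.92 ≤ c := by linarith
  have hc2 : c ≤ 0.9235 := by linarith
  have := mul_le_mul_of_nonneg_left hc1 (by linarith : (0 : ℝ) ≤ n)
  have := mul_le_mul_of_nonneg_left hc2 (by linarith : (0 : ℝ) ≤ n)
  constructor <;> linarith

theorem psi_le_of_large {n : ℕ} (hn : 720000 ≤ n) : Chebyshev.psi n ≤ 1.132 * n := by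
  have h1 := psi_le_logChebyshevQuotient_add n
  have h2 := psi_le_logChebyshevQuotient_add (n / 6)
  have h3 := psi_le_logChebyshevQuotient_add (n / 6 / 6)
  have b1 := (logChebyshevQuotient_bounds (n := n) (by lia)).2
  have b2 := (logChebyshevQuotient_bounds (n := n / 6) (by lia)).2
  have b3 := (logChebyshevQuotient_bounds (n := n / 6 / 6) (by lia)).2
  have h4 := Chebyshev.psi_le_const_mul_self (x := (n / 6 / 6 / 6 : ℕ)) (by positivity)
  have l4 : Real.log 4 ≤ 1.387 := by
    have := nat_mul_log_le_of_pow_le (a := 4) (b := 2) (i := 1) (j := 2)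
      (by norm_num) (by norm_num)
    push_cast at this
    linarith [Real.log_two_lt_d9]
  have d1 : ((n / 6 : ℕ) : ℝ) ≤ n / 6 := Nat.cast_div_le
  have d2 : ((n / 6 / 6 : ℕ) : ℝ) ≤ (n / 6 : ℕ) / 6 := Nat.cast_div_le
  have d3 : ((n / 6 / 6 / 6 : ℕ) : ℝ) ≤ (n / 6 / 6 : ℕ) / 6 := Nat.cast_div_le
  have := mul_le_mul_of_nonneg_right l4 (Nat.cast_nonneg (α := ℝ) (n / 6 / 6 / 6))
  linarith

open Finset in
theorem exists_prime_of_large {m : ℕ} (hm : 600000 ≤ m) :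
    ∃ p, p.Prime ∧ p ≤ 2 * m ∧ 4 * m + 1 < 3 * p := by
  by_contra! hno
  set a := (4 * m + 1) / 3 with ha
  have hθ : Chebyshev.theta (2 * m : ℕ) = Chebyshev.theta a := by
    rw [Chebyshev.theta, Chebyshev.theta, Nat.floor_natCast, Nat.floor_natCast]
    congr 1
    ext p
    simp only [mem_filter, mem_Ioc]
    refine ⟨fun h => ⟨⟨h.1.1, ?_⟩, h.2⟩, fun h => ⟨⟨h.1.1, by lia⟩, h.2⟩⟩
    have := hno p h.2 h.1.2
    lia
  have hm' : (600000 : ℝ) ≤ m := by exact_mod_cast hm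
  have h1 := (logChebyshevQuotient_bounds (n := 2 * m) (by lia)).1.trans
    (logChebyshevQuotient_le_psi _)
  have h2 := psi_le_of_large (n := a) (by lia)
  have h3 := Chebyshev.psi_sub_theta_le (x := (2 * m : ℕ)) (by push_cast; linarith)
  have h4 := Chebyshev.theta_le_psi a
  have h5 : (a : ℝ) ≤ (4 * m + 1 : ℕ) / 3 := Nat.cast_div_le
  push_cast at *
  set s := √(2 * m : ℝ) with hs
  have hs2 : s ^ 2 = 2 * m := Real.sq_sqrt (by positivity)
  have hs1 : 1000 ≤ s := Real.le_sqrt_of_sq_le (by linarith)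
  have hlog : Real.log (s / 1000) ≤ s / 1000 - 1 :=
    Real.log_le_sub_one_of_pos (by positivity)
  rw [Real.log_div (by linarith) (by norm_num)] at hlog
  have l1000 := nat_mul_log_le_of_pow_le (a := 1000) (b := 2) (i := 1) (j := 10)
    (by norm_num) (by norm_num)
  have hlog2 : Real.log (2 * m) = 2 * Real.log s := by
    rw [← hs2, Real.log_pow]
    norm_num
  push_cast at l1000
  have hb : Real.log (2 * m) ≤ 0.02 * s := by linarith [Real.log_two_lt_d9]
  have := mul_le_mul_of_nonneg_left hb (by linarith : 0 ≤ 2 * s)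
  nlinarith

theorem exists_prime_between {m : ℕ} (hm : 6 ≤ m) :
    ∃ p, p.Prime ∧ p ≤ 2 * m ∧ 4 * m + 1 < 3 * p := by
  rcases le_or_gt 600000 m with h | h
  · exact exists_prime_of_large h
  by_contra! hno
  have step (q p : ℕ) (hp : p.Prime) (hqp : 2 * q ≤ 3 * p) (hq : 2 * m < q) : 2 * m < p := by
    by_contra! hpm
    have := hno p hp hpm
    lia
  replace h : 2 * m < 1200000 := by lia
  replace h := step _ 921611 (by norm_num) (by norm_num) h
  replace h := step _ 614413 (by norm_num) (by norm_num) h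
  replace h := step _ 409609 (by norm_num) (by norm_num) h
  replace h := step _ 273083 (by norm_num) (by norm_num) h
  replace h := step _ 182059 (by norm_num) (by norm_num) h
  replace h := step _ 121379 (by norm_num) (by norm_num) h
  replace h := step _ 80923 (by norm_num) (by norm_num) h
  replace h := step _ 53951 (by norm_num) (by norm_num) h
  replace h := step _ 35969 (by norm_num) (by norm_num) h
  replace h := step _ 23981 (by norm_num) (by norm_num) h
  replace h := step _ 15991 (by norm_num) (by norm_num) h
  replace h := step _ 10667 (by norm_num) (by norm_num) h
  replace h := step _ 7121 (by norm_num) (by norm_num) h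
  replace h := step _ 4751 (by norm_num) (by norm_num) h
  replace h := step _ 3169 (by norm_num) (by norm_num) h
  replace h := step _ 2113 (by norm_num) (by norm_num) h
  replace h := step _ 1409 (by norm_num) (by norm_num) h
  replace h := step _ 941 (by norm_num) (by norm_num) h
  replace h := step _ 631 (by norm_num) (by norm_num) h
  replace h := step _ 421 (by norm_num) (by norm_num) h
  replace h := step _ 283 (by norm_num) (by norm_num) h
  replace h := step _ 193 (by norm_num) (by norm_num) h
  replace h := step _ 131 (by norm_num) (by norm_num) h
  replace h := step _ 89 (by norm_num) (by norm_num) h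
  replace h := step _ 61 (by norm_num) (by norm_num) h
  replace h := step _ 43 (by norm_num) (by norm_num) h
  replace h := step _ 31 (by norm_num) (by norm_num) h
  replace h := step _ 23 (by norm_num) (by norm_num) h
  replace h := step _ 19 (by norm_num) (by norm_num) h
  replace h := step _ 13 (by norm_num) (by norm_num) h
  replace h := step _ 11 (by norm_num) (by norm_num) h
  lia

theorem not_dvd_of_prime {m p : ℕ} (hm : 2 ≤ m) (hp : p.Prime) (hle : p ≤ 2 * m)
    (hlt : 4 * m + 1 < 3 * p) :
    ¬ ((2 * m + 1) * Nat.choose (2 * m) m ∣ (4 * m + 1) * Nat.choose (4 * m) (2 * m)) := by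
  intro hdvd
  have hchoose : p ∣ Nat.choose (2 * m) m :=
    hp.dvd_choose (by lia) (by lia) hle
  rcases hp.dvd_mul.1 ((hchoose.mul_left _).trans hdvd) with h | h
  · obtain ⟨c, hc⟩ := h
    have hc3 : c < 3 := by nlinarith
    interval_cases c <;> lia
  · have h0 := Nat.factorization_centralBinom_of_two_mul_self_lt_three_mul
      (n := 2 * m) (p := p) (by lia) hle (by lia)
    rw [Nat.centralBinom, show 2 * (2 * m) = 4 * m by ring] at h0
    have := hp.factorization_pos_of_dvd (Nat.choose_pos (by lia)).ne' h
    lia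

/-- For every integer `m ≥ 3`, the number `(2m+1)·C(2m, m)` does not divide
`(4m+1)·C(4m, 2m)`. -/
theorem stmt5 (m : ℕ) (hm : 3 ≤ m) :
    ¬ ((2 * m + 1) * Nat.choose (2 * m) m ∣ (4 * m + 1) * Nat.choose (4 * m) (2 * m)) := by
  rcases le_or_gt 6 m with h | h
  · obtain ⟨p, hp, hle, hlt⟩ := exists_prime_between h
    exact not_dvd_of_prime (by lia) hp hle hlt
  · interval_cases m <;> norm_num [Nat.choose]
end

section
/- For every integer d ≥ 2 there exists N such that for all integers m ≥ N, the binomial coefficient C(2m, m) does not divide C(2dm, dm). -/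
open Filter Topology Complex in
/-- The Dirichlet series of `Λ - 1` extends continuously to the closed half-plane
`1 ≤ re s`. -/
lemma exists_continuousOn_eq_LSeries_vonMangoldt_sub_one :
    ∃ G : ℂ → ℂ, ContinuousOn G {s | 1 ≤ s.re} ∧ ∀ s : ℂ, 1 < s.re →
      LSeries (fun n ↦ ((ArithmeticFunction.vonMangoldt n - 1 : ℝ) : ℂ)) s = G s := by
  have htriv : DirichletCharacter.LFunctionTrivChar 1 = riemannZeta :=
    DirichletCharacter.LFunction_modOne_eq
  set h := DirichletCharacter.LFunctionTrivChar₁ 1 with hdef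
  have hdiff : Differentiable ℂ h := DirichletCharacter.differentiable_LFunctionTrivChar₁ 1
  have h1 : h 1 = 1 := by simp [hdef, DirichletCharacter.LFunctionTrivChar₁]
  refine ⟨fun s ↦ -deriv h s / h s - dslope h 1 s, ?_, fun s hs ↦ ?_⟩
  · refine ((DirichletCharacter.continuousOn_neg_logDeriv_LFunctionTrivChar₁ 1).mono
      fun s hs ↦ Or.inr ?_).sub ?_
    · rw [htriv]
      exact riemannZeta_ne_zero_of_one_le_re hs
    · exact ((continuousOn_dslope univ_mem).2
        ⟨hdiff.continuous.continuousOn, hdiff 1⟩).mono (Set.subset_univ _)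
  · have hs1 : s ≠ 1 := by rintro rfl; simp at hs
    have hs1' : s - 1 ≠ 0 := sub_ne_zero.2 hs1
    have hζ : riemannZeta s ≠ 0 := riemannZeta_ne_zero_of_one_le_re hs.le
    have hfun : (fun n : ℕ ↦ ((ArithmeticFunction.vonMangoldt n - 1 : ℝ) : ℂ)) =
        (fun n : ℕ ↦ (ArithmeticFunction.vonMangoldt n : ℂ)) - 1 := by
      ext n; simp
    have hhs : h s = (s - 1) * riemannZeta s := by
      rw [hdef, DirichletCharacter.LFunctionTrivChar₁, Function.update_of_ne hs1, htriv]
    have hh's : deriv h s = (s - 1) * deriv riemannZeta s + riemannZeta s := by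
      rw [hdef, DirichletCharacter.deriv_LFunctionTrivChar₁_apply_of_ne_one 1 hs1, htriv]
    rw [hfun, LSeries_sub (ArithmeticFunction.LSeriesSummable_vonMangoldt hs)
      (LSeriesSummable_one_iff.2 hs),
      ArithmeticFunction.LSeries_vonMangoldt_eq_deriv_riemannZeta_div hs,
      LSeries_one_eq_riemannZeta hs]
    beta_reduce
    rw [dslope_of_ne _ hs1, slope_def_field, h1, hh's, hhs]
    field_simp
    ring

/-- The Fejér kernel: the Fourier transform of the triangle function `t ↦ 1 - |t| / T` supported
on `[-T, T]`. -/
noncomputable def fejerKernel (T u : ℝ) : ℝ := T * Real.sinc (T * u / 2) ^ 2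

lemma fejerKernel_nonneg {T : ℝ} (hT : 0 ≤ T) (u : ℝ) : 0 ≤ fejerKernel T u :=
  mul_nonneg hT (sq_nonneg _)

lemma fejerKernel_le {T : ℝ} (hT : 0 ≤ T) (u : ℝ) : fejerKernel T u ≤ T := by
  have := (sq_le_one_iff_abs_le_one _).2 (Real.abs_sinc_le_one (T * u / 2))
  exact mul_le_of_le_one_right hT this

lemma fejerKernel_mul_sq_le {T : ℝ} (hT : 0 < T) (u : ℝ) :
    fejerKernel T u * u ^ 2 ≤ 4 / T := by
  rcases eq_or_ne u 0 with rfl | hu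
  · simp; positivity
  · have hne : T * u / 2 ≠ 0 := by positivity
    have : fejerKernel T u * u ^ 2 = 4 / T * Real.sin (T * u / 2) ^ 2 := by
      rw [fejerKernel, Real.sinc_of_ne_zero hne]
      field_simp
      ring
    rw [this]
    exact mul_le_of_le_one_right (by positivity) (Real.sin_sq_le_one _)

lemma le_fejerKernel {T u : ℝ} (hT : 0 < T) (hu : |u| ≤ 1 / T) : T * (2 / 5) ≤ fejerKernel T u := by
  have hpi := Real.pi_gt_three
  have hpi' := Real.pi_lt_d2
  have hTu : |T * u / 2| ≤ 1 / 2 := by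
    rw [abs_div, abs_mul, abs_of_pos hT, abs_two]
    rw [le_div_iff₀ hT] at hu
    linarith
  have key : ∀ v : ℝ, |v| ≤ 1 / 2 → 2 / Real.pi ≤ Real.sinc v := by
    have hpos : ∀ v : ℝ, 0 < v → v ≤ 1 / 2 → 2 / Real.pi ≤ Real.sinc v := fun v h0 hv ↦ by
      rw [Real.sinc_of_ne_zero h0.ne', le_div_iff₀ h0]
      exact Real.mul_le_sin h0.le (by linarith)
    intro v hv
    rcases lt_trichotomy v 0 with h | rfl | h
    · rw [← Real.sinc_neg]
      exact hpos _ (by linarith) (by rwa [abs_of_neg h] at hv)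
    · rw [Real.sinc_zero, div_le_one (by positivity)]
      linarith
    · exact hpos _ h (by rwa [abs_of_pos h] at hv)
  have h2 : (2 / 5 : ℝ) ≤ (2 / Real.pi) ^ 2 := by
    rw [div_pow, div_le_div_iff₀ (by norm_num) (by positivity)]
    nlinarith
  rw [fejerKernel]
  gcongr
  exact h2.trans (by gcongr; exact key _ hTu)

lemma integral_one_sub_div_mul_cos {T : ℝ} (hT : 0 < T) (u : ℝ) :
    ∫ t in (0 : ℝ)..T, (1 - t / T) * (2 * Real.cos (t * u)) = fejerKernel T u := by
  rcases eq_or_ne u 0 with rfl | hu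
  · have h : ∀ x ∈ Set.uIcc 0 T, HasDerivAt (fun t : ℝ ↦ 2 * t - t ^ 2 / T)
        ((1 - x / T) * (2 * Real.cos (x * 0))) x := fun x _ ↦ by
      convert! ((hasDerivAt_id x).const_mul 2).sub ((hasDerivAt_pow 2 x).div_const T) using 1
      simp
      ring
    rw [intervalIntegral.integral_eq_sub_of_hasDerivAt h
      (Continuous.intervalIntegrable (by fun_prop) _ _)]
    simp [fejerKernel]
    field_simp
    ring
  · have h : ∀ x ∈ Set.uIcc 0 T, HasDerivAt
        (fun t : ℝ ↦ 2 * ((1 - t / T) * (Real.sin (t * u) / u) - Real.cos (t * u) / (T * u ^ 2)))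
        ((1 - x / T) * (2 * Real.cos (x * u))) x := fun x _ ↦ by
      have hx : HasDerivAt (fun t : ℝ ↦ t * u) u x := by
        simpa using (hasDerivAt_id x).mul_const u
      convert! ((((hasDerivAt_id x).div_const T).const_sub 1).mul
        (hx.sin.div_const u) |>.sub (hx.cos.div_const (T * u ^ 2))).const_mul 2 using 1
      simp
      field_simp
      ring
    rw [intervalIntegral.integral_eq_sub_of_hasDerivAt h
      (Continuous.intervalIntegrable (by fun_prop) _ _), fejerKernel,
      Real.sinc_of_ne_zero (by positivity)]
    have hcos : Real.cos (T * u) = 1 - 2 * Real.sin (T * u / 2) ^ 2 := by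
      rw [show T * u = 2 * (T * u / 2) by ring, Real.cos_two_mul, Real.cos_sq']
      ring_nf
    rw [hcos]
    simp
    field_simp
    ring

open Complex in
lemma integral_one_sub_abs_div_mul_exp {T : ℝ} (hT : 0 < T) (u : ℝ) :
    ∫ t in (-T)..T, ((1 - |t| / T : ℝ) : ℂ) * exp (t * u * I) = fejerKernel T u := by
  have hc : Continuous fun t : ℝ ↦ ((1 - |t| / T : ℝ) : ℂ) * exp (t * u * I) := by fun_prop
  have hc' : Continuous fun t : ℝ ↦ ((1 - |-t| / T : ℝ) : ℂ) * exp ((-t : ℝ) * u * I) := by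
    fun_prop
  rw [← intervalIntegral.integral_add_adjacent_intervals (b := 0) (hc.intervalIntegrable _ _)
    (hc.intervalIntegrable _ _), ← integral_one_sub_div_mul_cos hT,
    ← intervalIntegral.integral_ofReal]
  have hneg := intervalIntegral.integral_comp_neg (a := 0) (b := T)
    fun t : ℝ ↦ ((1 - |t| / T : ℝ) : ℂ) * exp (t * u * I)
  rw [neg_zero] at hneg
  rw [← hneg, ← intervalIntegral.integral_add
    (hc'.intervalIntegrable _ _) (hc.intervalIntegrable _ _)]
  refine intervalIntegral.integral_congr fun t ht ↦ ?_
  rw [Set.uIcc_of_le hT.le] at ht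
  simp only [abs_neg, abs_of_nonneg ht.1]
  push_cast
  rw [Complex.two_cos]
  ring_nf

/-- A prime `p` with `2 d m / (2 d - 1) < p < d m / (d - 1)` divides `C(2m, m)` but, by the theorem of
Lucas, not `C(2dm, dm)`. -/
lemma not_choose_dvd_choose_of_prime {d m p : ℕ} (hd : 2 ≤ d) (hm : 2 * d ≤ m) (hp : p.Prime)
    (h1 : 2 * d * m < (2 * d - 1) * p) (h2 : (d - 1) * p < d * m) :
    ¬ (Nat.choose (2 * m) m ∣ Nat.choose (2 * d * m) (d * m)) := by
  obtain ⟨e, rfl⟩ : ∃ e, d = e + 1 := ⟨d - 1, by omega⟩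
  have he : 1 ≤ e := by omega
  rw [show 2 * (e + 1) - 1 = 2 * e + 1 by omega] at h1
  rw [show e + 1 - 1 = e by omega] at h2
  have hmp : m < p := by
    by_contra! h
    nlinarith
  have hp2 : p < 2 * m := by nlinarith
  have hdvd : p ∣ Nat.choose (2 * m) m := by
    rw [two_mul]
    exact hp.dvd_choose_add hmp hmp (by omega)
  intro H
  have hdvd' := hdvd.trans H
  obtain ⟨r, hr⟩ : ∃ r, (e + 1) * m = r + p * e := ⟨(e + 1) * m - p * e, by
    have : p * e = e * p := mul_comm _ _
    omega⟩
  have h2r : 2 * r < p := by nlinarith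
  have hr2 : 2 * (e + 1) * m = 2 * r + p * (2 * e) := by linear_combination 2 * hr
  have := Fact.mk hp
  have hluc := Choose.choose_modEq_choose_mod_mul_choose_div_nat
    (n := 2 * (e + 1) * m) (k := (e + 1) * m) (p := p)
  rw [hr, hr2, Nat.add_mul_mod_self_left, Nat.add_mul_mod_self_left,
    Nat.add_mul_div_left _ _ hp.pos, Nat.add_mul_div_left _ _ hp.pos,
    Nat.mod_eq_of_lt h2r, Nat.mod_eq_of_lt (by omega : r < p), Nat.div_eq_of_lt h2r,
    Nat.div_eq_of_lt (by omega : r < p), zero_add, zero_add] at hluc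
  rw [hr, hr2] at hdvd'
  have hprod := (hluc.dvd_iff dvd_rfl).1 hdvd'
  have hsmall : ∀ n k, k ≤ n → n < p → ¬ p ∣ n.choose k := fun n k hk hn h ↦ by
    have h' : p ∣ n.factorial := by
      rw [← Nat.choose_mul_factorial_mul_factorial hk, mul_assoc]
      exact h.mul_right _
    exact absurd (hp.dvd_factorial.1 h') (by omega)
  rcases hp.dvd_mul.1 hprod with h | h
  · exact hsmall _ _ (by omega) h2r h
  · exact hsmall _ _ (by omega) (by omega) h

/-- If a nonnegative sequence has bounded mass on the unit windows of `log n`, then its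
convolution with the quadratically decaying kernel `u ↦ 1 / (1 + u ^ 2)` is bounded. -/
lemma exists_sum_mul_inv_le_of_window_le {a : ℕ → ℝ} (ha : ∀ n, 0 ≤ a n) {C : ℝ}
    (hC : ∀ (Y : ℝ) (S : Finset ℕ),
      (∀ n ∈ S, Y ≤ Real.log n ∧ Real.log n < Y + 1) → ∑ n ∈ S, a n ≤ C) :
    ∃ C' : ℝ, 0 ≤ C' ∧ ∀ (X : ℝ) (S : Finset ℕ),
      ∑ n ∈ S, a n * (1 + (X - Real.log n) ^ 2)⁻¹ ≤ C' := by
  have hC0 : 0 ≤ C := by simpa using hC 0 ∅ (by simp)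
  have hsum : Summable fun k : ℤ ↦ 3 * (1 + (k : ℝ) ^ 2)⁻¹ := by
    refine Summable.mul_left 3 (Summable.of_norm_bounded_eventually
      (Real.summable_one_div_int_pow.2 one_lt_two) ?_)
    filter_upwards [(Set.finite_singleton (0 : ℤ)).compl_mem_cofinite] with k hk
    have hk' : (k : ℝ) ≠ 0 := by simpa using hk
    rw [Real.norm_of_nonneg (by positivity), one_div]
    gcongr
    linarith
  refine ⟨C * ∑' k : ℤ, 3 * (1 + (k : ℝ) ^ 2)⁻¹,
    mul_nonneg hC0 (tsum_nonneg fun k ↦ by positivity), fun X S ↦ ?_⟩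
  have hpt : ∀ n ∈ S, a n * (1 + (X - Real.log n) ^ 2)⁻¹ ≤
      a n * (3 * (1 + (⌊Real.log n - X⌋ : ℝ) ^ 2)⁻¹) := fun n _ ↦ by
    refine mul_le_mul_of_nonneg_left ?_ (ha n)
    have h1 := Int.floor_le (Real.log n - X)
    have h2 := Int.lt_floor_add_one (Real.log n - X)
    set k : ℝ := (⌊Real.log n - X⌋ : ℝ)
    rw [← div_eq_mul_inv, ← one_div, div_le_div_iff₀ (by positivity) (by positivity)]
    nlinarith [sq_nonneg (Real.log n - X + k), sq_nonneg (k - 2 * (k - (Real.log n - X))),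
      sq_nonneg (Real.log n - X - k), mul_nonneg (sub_nonneg.2 h1) (sub_nonneg.2 h2.le)]
  calc _ ≤ ∑ n ∈ S, a n * (3 * (1 + (⌊Real.log n - X⌋ : ℝ) ^ 2)⁻¹) := Finset.sum_le_sum hpt
    _ = ∑ k ∈ S.image fun n : ℕ ↦ ⌊Real.log n - X⌋, ∑ n ∈ S with ⌊Real.log (n : ℕ) - X⌋ = k,
        a n * (3 * (1 + (⌊Real.log n - X⌋ : ℝ) ^ 2)⁻¹) :=
      (Finset.sum_fiberwise_of_maps_to (fun n hn ↦ Finset.mem_image_of_mem _ hn) _).symm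
    _ ≤ ∑ k ∈ S.image fun n : ℕ ↦ ⌊Real.log n - X⌋, C * (3 * (1 + (k : ℝ) ^ 2)⁻¹) := by
      refine Finset.sum_le_sum fun k _ ↦ ?_
      have : ∑ n ∈ S with ⌊Real.log (n : ℕ) - X⌋ = k,
          a n * (3 * (1 + (⌊Real.log n - X⌋ : ℝ) ^ 2)⁻¹) =
          (∑ n ∈ S with ⌊Real.log (n : ℕ) - X⌋ = k, a n) * (3 * (1 + (k : ℝ) ^ 2)⁻¹) := by
        rw [Finset.sum_mul]
        refine Finset.sum_congr rfl fun n hn ↦ ?_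
        rw [(Finset.mem_filter.1 hn).2]
      rw [this]
      refine mul_le_mul_of_nonneg_right (hC (X + k) _ fun n hn ↦ ?_) (by positivity)
      have := Int.floor_eq_iff.1 (Finset.mem_filter.1 hn).2
      constructor <;> linarith
    _ ≤ _ := by
      rw [← Finset.mul_sum]
      exact mul_le_mul_of_nonneg_left (hsum.sum_le_tsum _ fun k _ ↦ by positivity) hC0

lemma sum_vonMangoldt_add_one_div_le (Y : ℝ) (S : Finset ℕ)
    (hS : ∀ n ∈ S, Y ≤ Real.log n ∧ Real.log n < Y + 1) :
    ∑ n ∈ S, (ArithmeticFunction.vonMangoldt n + 1) / n ≤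
      (Real.log 4 + 5) * Real.exp 1 := by
  have hΛ : ∀ n, 0 ≤ ArithmeticFunction.vonMangoldt n := fun n ↦
    ArithmeticFunction.vonMangoldt_nonneg
  set N := ⌊Real.exp (Y + 1)⌋₊
  have hexp : 0 ≤ Real.exp (Y + 1) := (Real.exp_pos _).le
  have hpt : ∀ n ∈ S.erase 0, (ArithmeticFunction.vonMangoldt n + 1) / n ≤
      (ArithmeticFunction.vonMangoldt n + 1) * Real.exp (-Y) := fun n hn ↦ by
    have hn0 : (0 : ℝ) < n := by
      exact_mod_cast Nat.pos_of_ne_zero (Finset.ne_of_mem_erase hn)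
    rw [div_eq_mul_inv, Real.exp_neg]
    have := (Real.le_log_iff_exp_le hn0).1 (hS n (Finset.mem_of_mem_erase hn)).1
    gcongr
  have hsub : S.erase 0 ⊆ Finset.Ioc 0 N := fun n hn ↦ by
    have hn0 := Nat.pos_of_ne_zero (Finset.ne_of_mem_erase hn)
    refine Finset.mem_Ioc.2 ⟨hn0, Nat.le_floor ?_⟩
    exact ((Real.log_lt_iff_lt_exp (by exact_mod_cast hn0)).1
      (hS n (Finset.mem_of_mem_erase hn)).2).le
  calc _ = ∑ n ∈ S.erase 0, (ArithmeticFunction.vonMangoldt n + 1) / n :=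
        (Finset.sum_erase _ (by simp)).symm
    _ ≤ ∑ n ∈ S.erase 0, (ArithmeticFunction.vonMangoldt n + 1) * Real.exp (-Y) :=
        Finset.sum_le_sum hpt
    _ ≤ ∑ n ∈ Finset.Ioc 0 N, (ArithmeticFunction.vonMangoldt n + 1) * Real.exp (-Y) :=
        Finset.sum_le_sum_of_subset_of_nonneg hsub fun n _ _ ↦
          mul_nonneg (by linarith [hΛ n]) (Real.exp_pos _).le
    _ = (Chebyshev.psi (Real.exp (Y + 1)) + N) * Real.exp (-Y) := by
        rw [← Finset.sum_mul, Finset.sum_add_distrib, Chebyshev.psi]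
        simp [N]
    _ ≤ ((Real.log 4 + 4) * Real.exp (Y + 1) + Real.exp (Y + 1)) * Real.exp (-Y) := by
        gcongr
        · exact Chebyshev.psi_le_const_mul_self hexp
        · exact Nat.floor_le hexp
    _ = _ := by
        rw [← add_one_mul, mul_assoc, ← Real.exp_add]
        ring_nf

open Complex in
lemma LSeries_term_add_mul_I (f : ℕ → ℂ) (σ t : ℝ) (n : ℕ) :
    LSeries.term f (σ + t * I) n =
      LSeries.term f σ n * exp (t * (-Real.log n : ℝ) * I) := by
  rcases eq_or_ne n 0 with rfl | hn
  · simp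
  · have hn' : (n : ℂ) ≠ 0 := by exact_mod_cast hn
    rw [LSeries.term_of_ne_zero hn, LSeries.term_of_ne_zero hn, cpow_add _ _ hn',
      cpow_def_of_ne_zero hn' (t * I), ← natCast_log, div_mul_eq_div_div, div_eq_mul_inv _ (exp _),
      ← exp_neg]
    congr 2
    push_cast
    ring

open Complex in
lemma integral_mul_LSeries_eq_tsum_fejerKernel {f : ℕ → ℂ} {σ T : ℝ} (hT : 0 < T)
    (hf : LSeriesSummable f σ) (X : ℝ) :
    ∫ t in (-T)..T, ((1 - |t| / T : ℝ) : ℂ) * exp (t * X * I) * LSeries f (σ + t * I) =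
      ∑' n, LSeries.term f σ n * fejerKernel T (X - Real.log n) := by
  have hterm (n : ℕ) : ∫ t in (-T)..T,
      ((1 - |t| / T : ℝ) : ℂ) * exp (t * X * I) * LSeries.term f (σ + t * I) n =
      LSeries.term f σ n * fejerKernel T (X - Real.log n) := by
    rw [← integral_one_sub_abs_div_mul_exp hT, ← intervalIntegral.integral_const_mul]
    refine intervalIntegral.integral_congr fun t _ ↦ ?_
    have hexp : exp (t * (X - Real.log n : ℝ) * I) =
        exp (t * X * I) * exp (t * (-Real.log n : ℝ) * I) := by
      rw [← exp_add]
      congr 1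
      push_cast
      ring
    rw [LSeries_term_add_mul_I, hexp]
    ring
  have hnorm (t : ℝ) (n : ℕ) : ‖LSeries.term f (σ + t * I) n‖ = ‖LSeries.term f σ n‖ := by
    rw [LSeries.norm_term_eq, LSeries.norm_term_eq]
    simp
  simp_rw [← hterm]
  refine (intervalIntegral.hasSum_integral_of_dominated_convergence
    (fun n _ ↦ ‖LSeries.term f σ n‖) (fun n ↦ ?_) (fun n ↦ ?_) (.of_forall fun t _ ↦ hf.norm)
    (by simp) (.of_forall fun t _ ↦ ?_)).tsum_eq.symm
  · simp_rw [LSeries_term_add_mul_I]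
    exact Continuous.aestronglyMeasurable (by fun_prop)
  · refine .of_forall fun t ht ↦ ?_
    rw [Set.uIoc_of_le (by linarith)] at ht
    have habs : |t| / T ≤ 1 := (div_le_one hT).2 (abs_le.2 ⟨ht.1.le, ht.2⟩)
    have hnn : 0 ≤ |t| / T := by positivity
    have hexp : ‖exp (t * X * I)‖ = 1 := by
      exact_mod_cast norm_exp_ofReal_mul_I (t * X)
    rw [norm_mul, norm_mul, hexp, mul_one, hnorm, norm_real,
      Real.norm_of_nonneg (by linarith)]
    exact mul_le_of_le_one_left (norm_nonneg _) (by linarith)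
  · refine HasSum.mul_left _ (Summable.hasSum ?_)
    exact Summable.of_norm (by simpa only [hnorm] using hf.norm)

open Filter Topology Complex in
/-- The smoothed prime number theorem, with a Fejér kernel as weight. -/
lemma tendsto_tsum_vonMangoldt_sub_one_mul_fejerKernel {T : ℝ} (hT : 0 < T)
    (hsum : ∀ X : ℝ, Summable fun n : ℕ ↦
      (ArithmeticFunction.vonMangoldt n + 1) / n * fejerKernel T (X - Real.log n)) :
    Tendsto (fun X : ℝ ↦ ∑' n : ℕ,
      (ArithmeticFunction.vonMangoldt n - 1) / n * fejerKernel T (X - Real.log n))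
      atTop (𝓝 0) := by
  obtain ⟨G, hG, hGL⟩ := exists_continuousOn_eq_LSeries_vonMangoldt_sub_one
  set f : ℕ → ℂ := fun n ↦ ((ArithmeticFunction.vonMangoldt n - 1 : ℝ) : ℂ) with hfdef
  have hGc : Continuous fun q : ℝ × ℝ ↦ G ((max q.1 1 : ℝ) + q.2 * I) :=
    hG.comp_continuous (by fun_prop) fun q ↦ by simp
  have hΛ : ∀ n, 0 ≤ ArithmeticFunction.vonMangoldt n := fun n ↦
    ArithmeticFunction.vonMangoldt_nonneg
  have hlim (X : ℝ) : ((∑' n : ℕ, (ArithmeticFunction.vonMangoldt n - 1) / n *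
      fejerKernel T (X - Real.log n) : ℝ) : ℂ) =
      ∫ t in (-T)..T, ((1 - |t| / T : ℝ) : ℂ) * exp (t * X * I) * G (1 + t * I) := by
    have hint : Continuous fun σ : ℝ ↦ ∫ t in (-T)..T,
        ((1 - |t| / T : ℝ) : ℂ) * exp (t * X * I) * G ((max σ 1 : ℝ) + t * I) := by
      refine intervalIntegral.continuous_parametric_intervalIntegral_of_continuous' ?_ _ _
      exact Continuous.mul (by fun_prop) hGc
    have h1 := (hint.tendsto 1).mono_left (nhdsWithin_le_nhds (s := Set.Ioi 1))
    simp only [max_self, ofReal_one] at h1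
    refine tendsto_nhds_unique (f := fun σ : ℝ ↦ ∑' n, LSeries.term f σ n *
      fejerKernel T (X - Real.log n)) (l := 𝓝[>] 1) ?_ (h1.congr' ?_)
    · rw [ofReal_tsum]
      refine tendsto_tsum_of_dominated_convergence (hsum X) (fun n ↦ ?_) ?_
      · rcases eq_or_ne n 0 with rfl | hn
        · simp
        · have hn' : (n : ℂ) ≠ 0 := by exact_mod_cast hn
          simp_rw [LSeries.term_of_ne_zero hn]
          have hcont : Continuous fun σ : ℝ ↦
              f n / (n : ℂ) ^ (σ : ℂ) * fejerKernel T (X - Real.log n) := by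
            refine (continuous_const.div ?_ fun σ ↦ ?_).mul continuous_const
            · exact continuous_ofReal.const_cpow (Or.inl hn')
            · simp [cpow_eq_zero_iff, hn']
          have := (hcont.tendsto 1).mono_left (nhdsWithin_le_nhds (s := Set.Ioi 1))
          simpa [hfdef] using this
      · filter_upwards [self_mem_nhdsWithin] with σ hσ n
        have hσ' : (1 : ℝ) < σ := hσ
        rw [norm_mul, LSeries.norm_term_eq, norm_real (fejerKernel _ _),
          Real.norm_of_nonneg (fejerKernel_nonneg hT.le _)]
        refine mul_le_mul_of_nonneg_right ?_ (fejerKernel_nonneg hT.le _)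
        split_ifs with hn
        · simp [hn]
        · have hn1 : (1 : ℝ) ≤ n := by exact_mod_cast Nat.pos_of_ne_zero hn
          refine div_le_div₀ (by linarith [hΛ n]) ?_ (by linarith) ?_
          · rw [hfdef, norm_real, Real.norm_eq_abs, abs_le]
            constructor <;> linarith [hΛ n]
          · rw [ofReal_re]
            exact Real.self_le_rpow_of_one_le hn1 hσ'.le
    · filter_upwards [self_mem_nhdsWithin] with σ hσ
      have hσ' : (1 : ℝ) < σ := hσ
      have hsm : LSeriesSummable f σ := by
        have : f = (fun n : ℕ ↦ (ArithmeticFunction.vonMangoldt n : ℂ)) - 1 := by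
          ext n; simp [hfdef]
        rw [this]
        exact (ArithmeticFunction.LSeriesSummable_vonMangoldt (by simpa)).sub
          (LSeriesSummable_one_iff.2 (by simpa))
      rw [← integral_mul_LSeries_eq_tsum_fejerKernel hT hsm, max_eq_left hσ'.le]
      refine intervalIntegral.integral_congr fun t _ ↦ ?_
      rw [hGL _ (by simpa)]
  have hRL : Tendsto (fun X : ℝ ↦
      ∫ t in (-T)..T, ((1 - |t| / T : ℝ) : ℂ) * exp (t * X * I) * G (1 + t * I))
      atTop (𝓝 0) := by
    have hX : Tendsto (fun X : ℝ ↦ -X / (2 * Real.pi)) atTop (cocompact ℝ) :=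
      (tendsto_neg_atTop_atBot.atBot_div_const (by positivity)).mono_right atBot_le_cocompact
    refine ((Real.tendsto_integral_exp_smul_cocompact ((Set.Ioc (-T) T).indicator
      fun t : ℝ ↦ ((1 - |t| / T : ℝ) : ℂ) * G (1 + t * I))).comp hX).congr fun X ↦ ?_
    rw [intervalIntegral.integral_of_le (by linarith),
      ← MeasureTheory.integral_indicator measurableSet_Ioc]
    refine MeasureTheory.integral_congr_ae (.of_forall fun t ↦ ?_)
    beta_reduce
    by_cases ht : t ∈ Set.Ioc (-T) T
    · rw [Set.indicator_of_mem ht, Set.indicator_of_mem ht, Circle.smul_def, Real.fourierChar_apply,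
        smul_eq_mul]
      have : ((2 * Real.pi * (-(t * (-X / (2 * Real.pi)))) : ℝ) : ℂ) = t * X := by
        rw [← ofReal_mul]
        congr 1
        field_simp
      rw [this]
      ring
    · simp [Set.indicator_of_notMem ht]
  rw [← tendsto_ofReal_iff]
  simp_rw [hlim, ofReal_zero]
  exact hRL

open Filter Topology in
/-- Primes are eventually dense on a logarithmic scale: a consequence of the prime number
theorem. -/
theorem eventually_exists_prime_abs_sub_log_lt {δ : ℝ} (hδ : 0 < δ) :
    ∀ᶠ X : ℝ in atTop, ∃ p : ℕ, p.Prime ∧ |X - Real.log p| < δ := by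
  have hΛ : ∀ n, 0 ≤ ArithmeticFunction.vonMangoldt n := fun n ↦
    ArithmeticFunction.vonMangoldt_nonneg
  set a : ℕ → ℝ := fun n ↦ (ArithmeticFunction.vonMangoldt n + 1) / n with hadef
  have ha : ∀ n, 0 ≤ a n := fun n ↦ div_nonneg (by linarith [hΛ n]) n.cast_nonneg
  have hΛa : ∀ n : ℕ, ArithmeticFunction.vonMangoldt n / n ≤ a n := fun n ↦
    div_le_div_of_nonneg_right (by linarith) n.cast_nonneg
  have h1a : ∀ n : ℕ, 1 / (n : ℝ) ≤ a n := fun n ↦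
    div_le_div_of_nonneg_right (by linarith [hΛ n]) n.cast_nonneg
  obtain ⟨C, hC0, hC⟩ := exists_sum_mul_inv_le_of_window_le ha sum_vonMangoldt_add_one_div_le
  set w : ℝ → ℕ → ℝ := fun X n ↦ a n * (1 + (X - Real.log n) ^ 2)⁻¹ with hwdef
  have hw0 : ∀ X n, 0 ≤ w X n := fun X n ↦ mul_nonneg (ha n) (by positivity)
  have hws : ∀ X, Summable (w X) := fun X ↦ summable_of_sum_le (hw0 X) (hC X)
  have hwC : ∀ X, ∑' n, w X n ≤ C := fun X ↦ Real.tsum_le_of_sum_le (hw0 X) (hC X)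
  set D := 4 * (1 + 1 / δ ^ 2) * C with hD
  have hD0 : 0 ≤ D := by positivity
  set T := 1 + 50 * D with hTdef
  have hT : 0 < T := by positivity
  have hT1 : 1 ≤ T := by linarith
  set K : ℝ → ℕ → ℝ := fun X n ↦ fejerKernel T (X - Real.log n) with hKdef
  have hK0 : ∀ X n, 0 ≤ K X n := fun X n ↦ fejerKernel_nonneg hT.le _
  have hsum : ∀ X, Summable fun n ↦ a n * K X n := fun X ↦ by
    refine ((hws X).mul_left (T + 4 / T)).of_nonneg_of_le
      (fun n ↦ mul_nonneg (ha n) (hK0 X n)) fun n ↦ ?_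
    rw [hwdef, mul_left_comm]
    refine mul_le_mul_of_nonneg_left ?_ (ha n)
    rw [← div_eq_mul_inv, le_div_iff₀ (by positivity)]
    linarith [fejerKernel_le hT.le (X - Real.log n), fejerKernel_mul_sq_le hT (X - Real.log n)]
  have hsumΛ : ∀ X, Summable fun n : ℕ ↦ ArithmeticFunction.vonMangoldt n / n * K X n := fun X ↦
    (hsum X).of_nonneg_of_le
      (fun n ↦ mul_nonneg (div_nonneg (hΛ n) n.cast_nonneg) (hK0 X n)) fun n ↦
        mul_le_mul_of_nonneg_right (hΛa n) (hK0 X n)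
  have hsum1 : ∀ X, Summable fun n : ℕ ↦ 1 / (n : ℝ) * K X n := fun X ↦
    (hsum X).of_nonneg_of_le
      (fun n ↦ mul_nonneg (by positivity) (hK0 X n)) fun n ↦
        mul_le_mul_of_nonneg_right (h1a n) (hK0 X n)
  -- The contribution of proper prime powers is negligible.
  set P : ℕ → ℝ := fun n ↦ (if n.Prime then 0 else ArithmeticFunction.vonMangoldt n) / n with hPdef
  have hP0 : ∀ n, 0 ≤ P n := fun n ↦ div_nonneg (by split_ifs <;> simp [hΛ]) n.cast_nonneg
  have hPs : Summable P := by
    have := ArithmeticFunction.vonMangoldt.summable_residueClass_non_primes_div (0 : ZMod 1)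
    refine this.congr fun n ↦ ?_
    have hn : (n : ZMod 1) = 0 := Subsingleton.elim _ _
    simp [hPdef, ArithmeticFunction.vonMangoldt.residueClass, Set.indicator, hn]
  set Q : ℝ → ℕ → ℝ := fun X n ↦ if X - δ < Real.log n then P n else 0 with hQdef
  have hQ0 : ∀ X n, 0 ≤ Q X n := fun X n ↦ by rw [hQdef]; beta_reduce; split_ifs <;> simp [hP0]
  have hQle : ∀ X n, Q X n ≤ P n := fun X n ↦ by
    rw [hQdef]; beta_reduce; split_ifs <;> simp [hP0]
  have hQs : ∀ X, Summable (Q X) := fun X ↦ hPs.of_nonneg_of_le (hQ0 X) (hQle X)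
  have hQlim : Tendsto (fun X ↦ ∑' n, Q X n) atTop (𝓝 0) := by
    rw [← tsum_zero (β := ℕ)]
    refine tendsto_tsum_of_dominated_convergence hPs (fun n ↦ ?_) (.of_forall fun X n ↦ ?_)
    · refine tendsto_const_nhds.congr' ?_
      filter_upwards [eventually_ge_atTop (Real.log n + δ)] with X hX
      rw [hQdef]
      exact (if_neg (by linarith)).symm
    · rw [Real.norm_of_nonneg (hQ0 X n)]
      exact hQle X n
  have hexp : Tendsto (fun X : ℝ ↦ Real.exp (-X)) atTop (𝓝 0) :=
    Real.tendsto_exp_neg_atTop_nhds_zero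
  have hmain := tendsto_tsum_vonMangoldt_sub_one_mul_fejerKernel hT hsum
  filter_upwards [hmain.eventually (lt_mem_nhds (show (-(1 / 50) : ℝ) < 0 by norm_num)),
    hQlim.eventually (gt_mem_nhds (show (0 : ℝ) < 1 / (50 * T) by positivity)),
    hexp.eventually (gt_mem_nhds (show (0 : ℝ) < 1 / (50 * T) by positivity))] with X hXmain hXQ hXexp
  by_contra! hno
  have hupper : ∑' n : ℕ, ArithmeticFunction.vonMangoldt n / n * K X n ≤ 1 / 50 + 1 / 50 := by
    have hpt : ∀ n : ℕ, ArithmeticFunction.vonMangoldt n / n * K X n ≤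
        T * Q X n + 4 / T * (1 + 1 / δ ^ 2) * w X n := fun n ↦ by
      have hΛn : 0 ≤ ArithmeticFunction.vonMangoldt n / (n : ℝ) :=
        div_nonneg (hΛ n) n.cast_nonneg
      rcases lt_or_ge |X - Real.log n| δ with h | h
      · have hnp : ¬ n.Prime := fun hp ↦ absurd (hno n hp) (not_le.2 h)
        have hQn : Q X n = ArithmeticFunction.vonMangoldt n / n := by
          rw [hQdef]
          beta_reduce
          rw [if_pos (by linarith [(abs_lt.1 h).2]), hPdef]
          beta_reduce
          rw [if_neg hnp]
        have h1 : ArithmeticFunction.vonMangoldt n / n * K X n ≤ T * Q X n := by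
          rw [hQn, mul_comm]
          exact mul_le_mul_of_nonneg_right (fejerKernel_le hT.le _) hΛn
        have h2 : 0 ≤ 4 / T * (1 + 1 / δ ^ 2) * w X n := mul_nonneg (by positivity) (hw0 X n)
        linarith
      · have h1 : K X n ≤ 4 / T * (1 + 1 / δ ^ 2) * (1 + (X - Real.log n) ^ 2)⁻¹ := by
          set u := X - Real.log n with hu
          have hu2 : δ ^ 2 ≤ u ^ 2 := by
            rw [← sq_abs u]
            gcongr
          have hu0 : 0 < u ^ 2 := lt_of_lt_of_le (by positivity) hu2
          have hle : 1 + u ^ 2 ≤ (1 + 1 / δ ^ 2) * u ^ 2 := by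
            have : 1 ≤ 1 / δ ^ 2 * u ^ 2 := by
              rw [one_div_mul_eq_div, le_div_iff₀ (by positivity)]
              linarith
            linarith
          rw [← div_eq_mul_inv, le_div_iff₀ (by positivity)]
          calc K X n * (1 + u ^ 2) ≤ K X n * ((1 + 1 / δ ^ 2) * u ^ 2) :=
                mul_le_mul_of_nonneg_left hle (hK0 X n)
            _ = (K X n * u ^ 2) * (1 + 1 / δ ^ 2) := by ring
            _ ≤ 4 / T * (1 + 1 / δ ^ 2) :=
                mul_le_mul_of_nonneg_right (fejerKernel_mul_sq_le hT u) (by positivity)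
        calc _ ≤ a n * (4 / T * (1 + 1 / δ ^ 2) * (1 + (X - Real.log n) ^ 2)⁻¹) :=
              mul_le_mul (hΛa n) h1 (hK0 X n) (ha n)
          _ = 4 / T * (1 + 1 / δ ^ 2) * w X n := by rw [hwdef]; ring
          _ ≤ _ := le_add_of_nonneg_left (mul_nonneg hT.le (hQ0 X n))
    refine ((hsumΛ X).tsum_le_tsum hpt
      (((hQs X).mul_left _).add ((hws X).mul_left _))).trans ?_
    rw [((hQs X).mul_left _).tsum_add ((hws X).mul_left _), tsum_mul_left, tsum_mul_left]
    refine add_le_add ?_ ?_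
    · calc T * ∑' n, Q X n ≤ T * (1 / (50 * T)) := by gcongr
        _ = 1 / 50 := by field_simp
    · calc 4 / T * (1 + 1 / δ ^ 2) * ∑' n, w X n ≤ 4 / T * (1 + 1 / δ ^ 2) * C := by
            gcongr
            exact hwC X
        _ = D / T := by rw [hD]; ring
        _ ≤ 1 / 50 := by
            rw [div_le_div_iff₀ hT (by norm_num)]
            linarith
  have hlower : 9 / 50 ≤ ∑' n : ℕ, 1 / (n : ℝ) * K X n := by
    set A := ⌊Real.exp X⌋₊
    set B := ⌊Real.exp (X + 1 / T)⌋₊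
    have hpt : ∀ n ∈ Finset.Ioc A B,
        Real.exp (-(X + 1 / T)) * (T * (2 / 5)) ≤ 1 / (n : ℝ) * K X n := fun n hn ↦ by
      obtain ⟨hn1, hn2⟩ := Finset.mem_Ioc.1 hn
      have hn1' := (Nat.floor_lt (Real.exp_pos X).le).1 hn1
      have hn2' := (Nat.le_floor_iff (Real.exp_pos (X + 1 / T)).le).1 hn2
      have hnpos : (0 : ℝ) < n := (Real.exp_pos X).trans hn1'
      have hl1 := (Real.lt_log_iff_exp_lt hnpos).2 hn1'
      have hl2 := (Real.log_le_iff_le_exp hnpos).2 hn2'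
      refine mul_le_mul ?_ (le_fejerKernel hT ?_) (by positivity) (by positivity)
      · rw [Real.exp_neg, one_div (n : ℝ)]
        exact inv_anti₀ hnpos hn2'
      · rw [abs_le]
        constructor <;> linarith
    refine le_trans ?_ ((hsum1 X).sum_le_tsum (Finset.Ioc A B)
      fun n _ ↦ mul_nonneg (by positivity) (hK0 X n))
    refine le_trans ?_ (Finset.card_nsmul_le_sum _ _ _ hpt)
    have hAB : A ≤ B := Nat.floor_mono (Real.exp_le_exp.2 (by linarith [one_div_pos.2 hT]))
    rw [nsmul_eq_mul, Nat.card_Ioc, Nat.cast_sub hAB]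
    have hA : (A : ℝ) ≤ Real.exp X := Nat.floor_le (Real.exp_pos X).le
    have hB : Real.exp (X + 1 / T) - 1 < B := Nat.sub_one_lt_floor _
    have hE : Real.exp (-(1 / T)) ≤ 1 - 1 / (2 * T) := by
      have h1 : 1 + 1 / T ≤ Real.exp (1 / T) := by linarith [Real.add_one_le_exp (1 / T)]
      rw [Real.exp_neg]
      refine (inv_anti₀ (by positivity) h1).trans ?_
      rw [inv_le_iff_one_le_mul₀ (by positivity)]
      have : (1 - 1 / (2 * T)) * (1 + 1 / T) = 1 + (T - 1) / (2 * T ^ 2) := by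
        field_simp
        ring
      rw [this]
      have : 0 ≤ (T - 1) / (2 * T ^ 2) := div_nonneg (by linarith) (by positivity)
      linarith
    have h3 : Real.exp (-(X + 1 / T)) ≤ Real.exp (-X) :=
      Real.exp_le_exp.2 (by linarith [one_div_pos.2 hT])
    have h4 : (Real.exp (X + 1 / T) - 1 - Real.exp X) * Real.exp (-(X + 1 / T)) =
        1 - Real.exp (-(X + 1 / T)) - Real.exp (-(1 / T)) := by
      rw [sub_mul, sub_mul, ← Real.exp_add, ← Real.exp_add, one_mul]
      ring_nf
      simp
    calc (9 / 50 : ℝ) ≤ (1 / (2 * T) - 1 / (50 * T)) * (T * (2 / 5)) := by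
          field_simp
          norm_num
      _ ≤ (1 - Real.exp (-(X + 1 / T)) - Real.exp (-(1 / T))) * (T * (2 / 5)) := by
          refine mul_le_mul_of_nonneg_right ?_ (by positivity)
          linarith
      _ = (Real.exp (X + 1 / T) - 1 - Real.exp X) *
          (Real.exp (-(X + 1 / T)) * (T * (2 / 5))) := by rw [← h4]; ring
      _ ≤ _ := by
          refine mul_le_mul_of_nonneg_right ?_ (by positivity)
          linarith
  have hsub : ∑' n : ℕ, (ArithmeticFunction.vonMangoldt n - 1) / n * K X n =
      ∑' n : ℕ, ArithmeticFunction.vonMangoldt n / n * K X n - ∑' n : ℕ, 1 / (n : ℝ) * K X n := by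
    rw [← (hsumΛ X).tsum_sub (hsum1 X)]
    refine tsum_congr fun n ↦ ?_
    ring
  rw [hsub] at hXmain
  linarith

/-- For every `d ≥ 2` there exists `N` such that for all `m ≥ N`, the binomial coefficient
`C(2m, m)` does not divide `C(2dm, dm)`. -/
theorem stmt8 (d : ℕ) (hd : 2 ≤ d) :
    ∃ N : ℕ, ∀ m : ℕ, N ≤ m →
      ¬ (Nat.choose (2 * m) m ∣ Nat.choose (2 * d * m) (d * m)) := by
  have hd' : (2 : ℝ) ≤ d := by exact_mod_cast hd
  set α : ℝ := 2 * d / (2 * d - 1) with hα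
  set β : ℝ := d / (d - 1) with hβ
  have hα0 : 0 < α := div_pos (by linarith) (by linarith)
  have hβ0 : 0 < β := div_pos (by linarith) (by linarith)
  have hαβ : α < β := by
    rw [hα, hβ, div_lt_div_iff₀ (by linarith) (by linarith)]
    linarith
  have hlog : Real.log α < Real.log β := Real.log_lt_log hα0 hαβ
  have hlim : Filter.Tendsto (fun m : ℕ ↦ Real.log m + (Real.log α + Real.log β) / 2)
      Filter.atTop Filter.atTop :=
    Filter.tendsto_atTop_add_const_right _ _
      (Real.tendsto_log_atTop.comp tendsto_natCast_atTop_atTop)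
  have hev := hlim.eventually (eventually_exists_prime_abs_sub_log_lt
    (δ := (Real.log β - Real.log α) / 2) (by linarith))
  obtain ⟨N, hN⟩ := Filter.eventually_atTop.1 (hev.and (Filter.eventually_ge_atTop (2 * d)))
  refine ⟨N, fun m hm ↦ ?_⟩
  obtain ⟨⟨p, hp, hpX⟩, hmd⟩ := hN m hm
  have hm0 : (0 : ℝ) < m := by
    exact_mod_cast lt_of_lt_of_le (by omega : 0 < 2 * d) hmd
  have hp0 : (0 : ℝ) < p := by exact_mod_cast hp.pos
  rw [abs_lt] at hpX
  have h1 : α * m < p := by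
    rw [← Real.log_lt_log_iff (by positivity) hp0, Real.log_mul hα0.ne' hm0.ne']
    linarith [hpX.2]
  have h2 : p < β * m := by
    rw [← Real.log_lt_log_iff hp0 (by positivity), Real.log_mul hβ0.ne' hm0.ne']
    linarith [hpX.1]
  refine not_choose_dvd_choose_of_prime hd hmd hp ?_ ?_
  · rw [hα, div_mul_eq_mul_div, div_lt_iff₀ (by linarith)] at h1
    have h : ((2 * d * m : ℕ) : ℝ) < ((2 * d - 1 : ℕ) * p : ℕ) := by
      push_cast [Nat.cast_sub (by omega : 1 ≤ 2 * d)]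
      linarith
    exact_mod_cast h
  · rw [hβ, div_mul_eq_mul_div, lt_div_iff₀ (by linarith)] at h2
    have h : (((d - 1 : ℕ) * p : ℕ) : ℝ) < (d * m : ℕ) := by
      push_cast [Nat.cast_sub (by omega : 1 ≤ d)]
      linarith
    exact_mod_cast h
end
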